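/- Let G be a finite tree with vertex set V and graph distance d, let P₁, …, P_k (k ≥ 1) be pairwise disjoint pairs P_i = {v_i, u_i} of distinct vertices of G, let W = P₁ ∪ ⋯ ∪ P_k, and let α, β ∈ W satisfy d(α, β) = max_{u,w ∈ W} d(u, w). Then there exists an assignment σ* that minimizes max(diam(Red(σ)), diam(Blue(σ))) over all assignments σ and that additionally satisfies, for every i ∈ {1, …, k}, max(d(r_i(σ*), α), d(b_i(σ*), β)) ≤ max(d(b_i(σ*), α), d(r_i(σ*), β)). -/

import Mathlib

/-- The diameter of a finite vertex set `S` in a graph `G`: `max_{x,y ∈ S} d(x, y)`. -/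
noncomputable def finsetDiam {V : Type*} (G : SimpleGraph V) (S : Finset V) : ℕ :=
  S.sup fun x => S.sup fun y => G.dist x y

/-- The red vertex of the pair `{v i, u i}` under the assignment `σ`. -/
def redVtx {V : Type*} {k : ℕ} (v u : Fin k → V) (σ : Fin k → Bool) (i : Fin k) : V :=
  if σ i then v i else u i

/-- The blue vertex of the pair `{v i, u i}` under the assignment `σ`. -/
def blueVtx {V : Type*} {k : ℕ} (v u : Fin k → V) (σ : Fin k → Bool) (i : Fin k) : V :=
  if σ i then u i else v i

/-- The set of red vertices under the assignment `σ`. -/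
def redSet {V : Type*} [DecidableEq V] {k : ℕ} (v u : Fin k → V)
    (σ : Fin k → Bool) : Finset V :=
  Finset.univ.image (redVtx v u σ)

/-- The set of blue vertices under the assignment `σ`. -/
def blueSet {V : Type*} [DecidableEq V] {k : ℕ} (v u : Fin k → V)
    (σ : Fin k → Bool) : Finset V :=
  Finset.univ.image (blueVtx v u σ)

namespace SimpleGraph

variable {V : Type*} {G : SimpleGraph V}

/-- In a tree, every path is a shortest path. -/
lemma IsTree.length_eq_dist_of_isPath (hT : G.IsTree) {x y : V} {p : G.Walk x y}
    (hp : p.IsPath) : p.length = G.dist x y := by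
  obtain ⟨q, hq, hlen⟩ := hT.connected.exists_path_of_dist x y
  have h := (hT.isAcyclic.subsingleton_path x y).elim ⟨p, hp⟩ ⟨q, hq⟩
  rw [Subtype.mk.injEq] at h
  rw [h, hlen]

/-- In a tree, distances add up along a path. -/
lemma IsTree.dist_add_dist_of_mem_support [DecidableEq V] (hT : G.IsTree) {x y z : V}
    {p : G.Walk x y} (hp : p.IsPath) (hz : z ∈ p.support) :
    G.dist x z + G.dist z y = G.dist x y := by
  rw [← hT.length_eq_dist_of_isPath hp, ← hT.length_eq_dist_of_isPath (hp.takeUntil hz),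
    ← hT.length_eq_dist_of_isPath (hp.dropUntil hz), ← Walk.length_append, Walk.take_spec]

/-- In a tree, if the start `g` of a path is a vertex of the path closest to `a`, then the path
extends a shortest path from `a` to `g`. -/
lemma IsTree.dist_eq_add_of_forall_dist_le [DecidableEq V] (hT : G.IsTree) {a g y : V}
    {q : G.Walk g y} (hq : q.IsPath) (hmin : ∀ z ∈ q.support, G.dist a g ≤ G.dist a z) :
    G.dist a y = G.dist a g + G.dist g y := by
  obtain ⟨p, hp, -⟩ := hT.connected.exists_path_of_dist a g
  have hpq : (p.append q).IsPath := by
    rw [Walk.isPath_def, Walk.support_append, List.nodup_append']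
    have hq' := hq.support_nodup
    rw [← Walk.cons_tail_support, List.nodup_cons] at hq'
    refine ⟨hp.support_nodup, hq'.2, fun z hzp hzq => hq'.1 ?_⟩
    have h₁ := hT.dist_add_dist_of_mem_support hp hzp
    have h₂ := hmin z (List.mem_of_mem_tail hzq)
    have h₃ : z = g := hT.connected.dist_eq_zero_iff.mp (by omega)
    exact h₃ ▸ hzq
  rw [← hT.length_eq_dist_of_isPath hpq, Walk.length_append, hT.length_eq_dist_of_isPath hp,
    hT.length_eq_dist_of_isPath hq]

/-- In a tree, every path has a vertex through which a given vertex reaches both ends. -/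
lemma IsTree.exists_mem_support_dist_eq_add [DecidableEq V] (hT : G.IsTree) {x y : V}
    {p : G.Walk x y} (hp : p.IsPath) (a : V) :
    ∃ g ∈ p.support,
      G.dist a x = G.dist a g + G.dist g x ∧ G.dist a y = G.dist a g + G.dist g y := by
  obtain ⟨g, hg, hmin⟩ := p.support.toFinset.exists_min_image (G.dist a)
    ⟨x, List.mem_toFinset.mpr p.start_mem_support⟩
  simp only [List.mem_toFinset] at hg hmin
  refine ⟨g, hg, hT.dist_eq_add_of_forall_dist_le (hp.takeUntil hg).reverse fun z hz => ?_,
    hT.dist_eq_add_of_forall_dist_le (hp.dropUntil hg) fun z hz => ?_⟩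
  · rw [Walk.support_reverse, List.mem_reverse] at hz
    exact hmin z (p.support_takeUntil_subset_support hg hz)
  · exact hmin z (p.support_dropUntil_subset_support hg hz)

/-- In a tree, the distance between two vertices of a path is the difference of their distances
from its start. -/
lemma IsTree.dist_add_dist_of_mem_support_of_le [DecidableEq V] (hT : G.IsTree) {x y z w : V}
    {p : G.Walk x y} (hp : p.IsPath) (hz : z ∈ p.support) (hw : w ∈ p.support)
    (hle : G.dist x z ≤ G.dist x w) : G.dist x z + G.dist z w = G.dist x w := by
  have hw' := hw
  rw [← Walk.take_spec p hz, Walk.mem_support_append_iff] at hw'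
  have h₁ := hT.dist_add_dist_of_mem_support hp hz
  have h₂ := hT.dist_add_dist_of_mem_support hp hw
  rcases hw' with h | h
  · have h₃ := hT.dist_add_dist_of_mem_support (hp.takeUntil hz) h
    have h₄ := G.dist_comm (u := w) (v := z)
    omega
  · have h₃ := hT.dist_add_dist_of_mem_support (hp.dropUntil hz) h
    omega

/-- The four-point condition for the distance of a tree. -/
theorem IsTree.dist_add_dist_le_max [DecidableEq V] (hT : G.IsTree) (x y a b : V) :
    G.dist x y + G.dist a b ≤
      max (G.dist x a + G.dist y b) (G.dist x b + G.dist y a) := by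
  obtain ⟨p, hp, -⟩ := hT.connected.exists_path_of_dist x y
  obtain ⟨g, hg, hgx, hgy⟩ := hT.exists_mem_support_dist_eq_add hp a
  obtain ⟨h, hh, hhx, hhy⟩ := hT.exists_mem_support_dist_eq_add hp b
  have hg' := hT.dist_add_dist_of_mem_support hp hg
  have hh' := hT.dist_add_dist_of_mem_support hp hh
  have h₁ : G.dist a b ≤ G.dist a g + G.dist g b := hT.connected.dist_triangle
  have h₂ : G.dist g b ≤ G.dist g h + G.dist h b := hT.connected.dist_triangle
  rw [G.dist_comm (u := x) (v := a), G.dist_comm (u := x) (v := b),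
    G.dist_comm (u := y) (v := a), G.dist_comm (u := y) (v := b)]
  rw [G.dist_comm (u := h) (v := b)] at h₂
  rw [G.dist_comm (u := g) (v := x)] at hgx
  rw [G.dist_comm (u := h) (v := x)] at hhx
  rcases le_total (G.dist x g) (G.dist x h) with hle | hle
  · have h₃ := hT.dist_add_dist_of_mem_support_of_le hp hg hh hle
    omega
  · have h₃ := hT.dist_add_dist_of_mem_support_of_le hp hh hg hle
    rw [G.dist_comm (u := h) (v := g)] at h₃
    omega

end SimpleGraph

lemma dist_le_finsetDiam {V : Type*} (G : SimpleGraph V) {S : Finset V} {x y : V}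
    (hx : x ∈ S) (hy : y ∈ S) : G.dist x y ≤ finsetDiam G S :=
  (Finset.le_sup (f := fun y => G.dist x y) hy).trans
    (Finset.le_sup (f := fun x => S.sup fun y => G.dist x y) hx)

lemma finsetDiam_le_iff {V : Type*} (G : SimpleGraph V) {S : Finset V} {n : ℕ} :
    finsetDiam G S ≤ n ↔ ∀ x ∈ S, ∀ y ∈ S, G.dist x y ≤ n := by
  simp only [finsetDiam, Finset.sup_le_iff]

/-- If `a`, `b` is a diametral pair of a vertex set `W` of a tree, then two vertices of `W` are at
most as far apart as one of them is from `a`. -/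
lemma SimpleGraph.IsTree.dist_le_max_dist_of_diametral {V : Type*} [DecidableEq V]
    {G : SimpleGraph V} (hT : G.IsTree) {W : Finset V} {a b : V}
    (hab : finsetDiam G W ≤ G.dist a b) (hb : b ∈ W) {x y : V} (hx : x ∈ W) (hy : y ∈ W) :
    G.dist x y ≤ max (G.dist x a) (G.dist y a) := by
  have h := hT.dist_add_dist_le_max x y a b
  have hxb := (dist_le_finsetDiam G hx hb).trans hab
  have hyb := (dist_le_finsetDiam G hy hb).trans hab
  omega

/-- The diameter objective of an assignment is at least the greedy cost of every pair. -/
lemma min_max_dist_le_max_finsetDiam {V : Type*} [DecidableEq V] (G : SimpleGraph V) {k : ℕ}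
    (v u : Fin k → V) {W : Finset V} (hv : ∀ i, v i ∈ W) (hu : ∀ i, u i ∈ W)
    (hW : ∀ w ∈ W, ∃ i, v i = w ∨ u i = w) {α β : V} (hα : α ∈ W) (hβ : β ∈ W)
    (hαβ : finsetDiam G W ≤ G.dist α β) (σ : Fin k → Bool) (i : Fin k) :
    min (max (G.dist (v i) α) (G.dist (u i) β)) (max (G.dist (u i) α) (G.dist (v i) β)) ≤
      max (finsetDiam G (redSet v u σ)) (finsetDiam G (blueSet v u σ)) := by
  have hcol : ∀ w ∈ W, w ∈ redSet v u σ ∨ w ∈ blueSet v u σ := by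
    intro w hw
    obtain ⟨j, hj⟩ := hW w hw
    simp only [redSet, blueSet, Finset.mem_image, Finset.mem_univ, true_and, redVtx, blueVtx]
    cases hσ : σ j <;> rcases hj with hj | hj
    · exact .inr ⟨j, by simp [hσ, hj]⟩
    · exact .inl ⟨j, by simp [hσ, hj]⟩
    · exact .inl ⟨j, by simp [hσ, hj]⟩
    · exact .inr ⟨j, by simp [hσ, hj]⟩
  have hr : redVtx v u σ i ∈ redSet v u σ := Finset.mem_image_of_mem _ (Finset.mem_univ i)
  have hb : blueVtx v u σ i ∈ blueSet v u σ := Finset.mem_image_of_mem _ (Finset.mem_univ i)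
  have hval : redVtx v u σ i = v i ∧ blueVtx v u σ i = u i ∨
      redVtx v u σ i = u i ∧ blueVtx v u σ i = v i := by
    cases hσ : σ i <;> simp [redVtx, blueVtx, hσ]
  have h₁ := (dist_le_finsetDiam G (hv i) hα).trans hαβ
  have h₂ := (dist_le_finsetDiam G (hu i) hβ).trans hαβ
  rcases hcol α hα with hα' | hα' <;> rcases hcol β hβ with hβ' | hβ'
  · have h₃ := dist_le_finsetDiam G hα' hβ'
    omega
  · have h₃ := dist_le_finsetDiam G hr hα'
    have h₄ := dist_le_finsetDiam G hb hβ'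
    rcases hval with ⟨e, e'⟩ | ⟨e, e'⟩ <;> rw [e] at h₃ <;> rw [e'] at h₄ <;> omega
  · have h₃ := dist_le_finsetDiam G hb hα'
    have h₄ := dist_le_finsetDiam G hr hβ'
    rcases hval with ⟨e, e'⟩ | ⟨e, e'⟩ <;> rw [e'] at h₃ <;> rw [e] at h₄ <;> omega
  · have h₃ := dist_le_finsetDiam G hα' hβ'
    omega

/-- The discrete form of Lemma 7 of the paper: for a diametral pair `α, β` of the set `W` of
all paired vertices, there is an assignment `σ*` minimizing
`max(diam(Red(σ)), diam(Blue(σ)))` in which every pair is assigned greedily with respect to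
`(α, β)`: `max(d(r i, α), d(b i, β)) ≤ max(d(b i, α), d(r i, β))` for every `i`. -/
theorem stmt_10 {V : Type*} [Fintype V] [DecidableEq V] (G : SimpleGraph V)
    (hT : G.IsTree) (k : ℕ) (hk : 1 ≤ k) (v u : Fin k → V)
    (hvu : ∀ i, v i ≠ u i)
    (hdisj : ∀ i j : Fin k, i ≠ j → ({v i, u i} : Set V) ∩ {v j, u j} = ∅)
    (W : Finset V) (hW : W = Finset.univ.image v ∪ Finset.univ.image u)
    (α β : V) (hα : α ∈ W) (hβ : β ∈ W)
    (hαβ : G.dist α β = W.sup fun x => W.sup fun y => G.dist x y) :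
    ∃ σs : Fin k → Bool,
      (∀ σ : Fin k → Bool,
        max (finsetDiam G (redSet v u σs)) (finsetDiam G (blueSet v u σs)) ≤
          max (finsetDiam G (redSet v u σ)) (finsetDiam G (blueSet v u σ))) ∧
      (∀ i : Fin k,
        max (G.dist (redVtx v u σs i) α) (G.dist (blueVtx v u σs i) β) ≤
          max (G.dist (blueVtx v u σs i) α) (G.dist (redVtx v u σs i) β)) := by
  have hv : ∀ i, v i ∈ W := fun i => by simp [hW]
  have hu : ∀ i, u i ∈ W := fun i => by simp [hW]
  have hcov : ∀ w ∈ W, ∃ i, v i = w ∨ u i = w := by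
    intro w hw
    simpa [hW, exists_or] using hw
  have hdiam : finsetDiam G W ≤ G.dist α β := hαβ.ge
  have hdiam' : finsetDiam G W ≤ G.dist β α := by rwa [G.dist_comm]
  let σs : Fin k → Bool := fun i =>
    decide (max (G.dist (v i) α) (G.dist (u i) β) ≤ max (G.dist (u i) α) (G.dist (v i) β))
  have hσs : ∀ i, redVtx v u σs i ∈ W ∧ blueVtx v u σs i ∈ W ∧
      max (G.dist (redVtx v u σs i) α) (G.dist (blueVtx v u σs i) β) =
        min (max (G.dist (v i) α) (G.dist (u i) β)) (max (G.dist (u i) α) (G.dist (v i) β)) ∧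
      max (G.dist (redVtx v u σs i) α) (G.dist (blueVtx v u σs i) β) ≤
        max (G.dist (blueVtx v u σs i) α) (G.dist (redVtx v u σs i) β) := by
    intro i
    by_cases h : max (G.dist (v i) α) (G.dist (u i) β) ≤ max (G.dist (u i) α) (G.dist (v i) β)
    · have hi : σs i = true := decide_eq_true h
      simp only [redVtx, blueVtx, hi, if_true]
      exact ⟨hv i, hu i, (min_eq_left h).symm, h⟩
    · have hi : σs i = false := decide_eq_false h
      simp only [redVtx, blueVtx, hi, Bool.false_eq_true, if_false]
      exact ⟨hu i, hv i, (min_eq_right (not_le.mp h).le).symm, (not_le.mp h).le⟩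
  refine ⟨σs, fun σ => ?_, fun i => (hσs i).2.2.2⟩
  have hle : ∀ i, max (G.dist (redVtx v u σs i) α) (G.dist (blueVtx v u σs i) β) ≤
      max (finsetDiam G (redSet v u σ)) (finsetDiam G (blueSet v u σ)) := fun i =>
    (hσs i).2.2.1.trans_le
      (min_max_dist_le_max_finsetDiam G v u hv hu hcov hα hβ hdiam σ i)
  refine max_le ((finsetDiam_le_iff G).mpr ?_) ((finsetDiam_le_iff G).mpr ?_)
  · simp only [redSet, Finset.forall_mem_image, Finset.mem_univ, true_imp_iff]
    exact fun i j =>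
      (hT.dist_le_max_dist_of_diametral hdiam hβ (hσs i).1 (hσs j).1).trans
        (max_le ((le_max_left _ _).trans (hle i)) ((le_max_left _ _).trans (hle j)))
  · simp only [blueSet, Finset.forall_mem_image, Finset.mem_univ, true_imp_iff]
    exact fun i j =>
      (hT.dist_le_max_dist_of_diametral hdiam' hα (hσs i).2.1 (hσs j).2.1).trans
        (max_le ((le_max_right _ _).trans (hle i)) ((le_max_right _ _).trans (hle j)))
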